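/- arXiv:1209.5870 — 2 statements merged into one kernel-verified Lean document; each statement's English description precedes it below -/
import Mathlib

section
/- A generalized almost complex structure on V (endomorphism 𝒥 of V ⊕ V* with 𝒥² = -Id, skew-adjoint for the canonical pairing) determines a maximal isotropic subspace L ⊂ (V ⊕ V*) ⊗ ℂ with L ∩ conj(L) = {0}, namely the +i-eigenspace of the complexification of 𝒥. -/
open TensorProduct

/-- The canonical pairing on `V ⊕ V*` as a bilinear form. -/
noncomputable def pairingForm (V : Type*) [AddCommGroup V] [Module ℝ V] :
    LinearMap.BilinForm ℝ (V × Module.Dual ℝ V) :=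
  LinearMap.mk₂ ℝ (fun a b => (a.2 b.1 + b.2 a.1) / 2)
    (fun a a' b => by simp [Prod.fst_add, Prod.snd_add]; ring)
    (fun c a b => by simp [Prod.smul_fst, Prod.smul_snd, smul_eq_mul]; ring)
    (fun a b b' => by simp [Prod.fst_add, Prod.snd_add]; ring)
    (fun c a b => by simp [Prod.smul_fst, Prod.smul_snd, smul_eq_mul]; ring)

section Complexification

variable {W : Type*} [AddCommGroup W] [Module ℝ W]

/-- Complex conjugation on the complexification of a real vector space. -/
noncomputable def complexificationConj (W : Type*) [AddCommGroup W] [Module ℝ W] :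
    (ℂ ⊗[ℝ] W) →ₗ[ℝ] (ℂ ⊗[ℝ] W) :=
  TensorProduct.map Complex.conjAe.toLinearMap (LinearMap.id : W →ₗ[ℝ] W)

theorem complexificationConj_tmul (z : ℂ) (w : W) :
    complexificationConj W (z ⊗ₜ[ℝ] w) = (starRingEnd ℂ z) ⊗ₜ[ℝ] w := rfl

theorem complexificationConj_conj (x : ℂ ⊗[ℝ] W) :
    complexificationConj W (complexificationConj W x) = x := by
  induction x with
  | zero => simp
  | tmul z w => simp [complexificationConj_tmul]
  | add x y hx hy => rw [map_add, map_add, hx, hy]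

theorem complexificationConj_smul (c : ℂ) (x : ℂ ⊗[ℝ] W) :
    complexificationConj W (c • x) = (starRingEnd ℂ c) • complexificationConj W x := by
  induction x with
  | zero => simp
  | tmul z w => simp [complexificationConj_tmul, TensorProduct.smul_tmul']
  | add x y hx hy => rw [smul_add, map_add, hx, hy, map_add, smul_add]

theorem baseChange_complexificationConj (J : W →ₗ[ℝ] W) (x : ℂ ⊗[ℝ] W) :
    J.baseChange ℂ (complexificationConj W x) = complexificationConj W (J.baseChange ℂ x) := by
  induction x with
  | zero => simp
  | tmul z w => simp [complexificationConj_tmul]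
  | add x y hx hy => simp only [map_add, hx, hy]

theorem complexificationConj_mem_eigenspace (J : W →ₗ[ℝ] W) (μ : ℂ) {x : ℂ ⊗[ℝ] W}
    (hx : x ∈ Module.End.eigenspace (R := ℂ) (M := ℂ ⊗[ℝ] W) (J.baseChange ℂ) μ) :
    complexificationConj W x ∈
      Module.End.eigenspace (R := ℂ) (M := ℂ ⊗[ℝ] W) (J.baseChange ℂ) (starRingEnd ℂ μ) := by
  rw [Module.End.mem_eigenspace_iff] at hx ⊢
  rw [baseChange_complexificationConj, hx, complexificationConj_smul]

theorem LinearMap.baseChange_baseChange_eq_neg {J : W →ₗ[ℝ] W} (hJ : J ∘ₗ J = -LinearMap.id)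
    (x : ℂ ⊗[ℝ] W) : J.baseChange ℂ (J.baseChange ℂ x) = -x := by
  induction x with
  | zero => simp
  | tmul z w =>
    have h : J (J w) = -w := LinearMap.congr_fun hJ w
    simp [h, TensorProduct.tmul_neg]
  | add x y hx hy => rw [map_add, map_add, hx, hy, neg_add]

theorem LinearMap.BilinForm.baseChange_skew {B : LinearMap.BilinForm ℝ W} {J : W →ₗ[ℝ] W}
    (h : ∀ a b, B (J a) b = -B a (J b)) (x y : ℂ ⊗[ℝ] W) :
    LinearMap.BilinForm.baseChange ℂ B (J.baseChange ℂ x) y =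
      -LinearMap.BilinForm.baseChange ℂ B x (J.baseChange ℂ y) := by
  induction x with
  | zero => simp
  | add x x' hx hx' => simp only [map_add, LinearMap.add_apply, hx, hx', neg_add]
  | tmul z w =>
    induction y with
    | zero => simp
    | add y y' hy hy' => simp only [map_add, hy, hy', neg_add]
    | tmul z' w' => simp [h]

/-- Conjugation identifies an eigenspace of a complexified real operator with the one for the
conjugate eigenvalue. -/
noncomputable def eigenspaceConjEquiv (J : W →ₗ[ℝ] W) :
    Module.End.eigenspace (R := ℂ) (M := ℂ ⊗[ℝ] W) (J.baseChange ℂ) Complex.I ≃ₗ[ℝ]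
      Module.End.eigenspace (R := ℂ) (M := ℂ ⊗[ℝ] W) (J.baseChange ℂ) (-Complex.I) where
  toFun x := ⟨complexificationConj W x, by
    simpa using complexificationConj_mem_eigenspace J Complex.I x.2⟩
  invFun x := ⟨complexificationConj W x, by
    simpa using complexificationConj_mem_eigenspace J (-Complex.I) x.2⟩
  map_add' x y := by ext; simp
  map_smul' c x := by ext; simp
  left_inv x := by ext; exact complexificationConj_conj _
  right_inv x := by ext; exact complexificationConj_conj _

theorem isCompl_eigenspace_I {J : W →ₗ[ℝ] W} (hJ : J ∘ₗ J = -LinearMap.id) :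
    IsCompl (Module.End.eigenspace (R := ℂ) (M := ℂ ⊗[ℝ] W) (J.baseChange ℂ) Complex.I)
      (Module.End.eigenspace (R := ℂ) (M := ℂ ⊗[ℝ] W) (J.baseChange ℂ) (-Complex.I)) := by
  have hI : Complex.I ≠ -Complex.I := by simp [self_eq_neg]
  refine ⟨(Module.End.eigenspaces_iSupIndep _).pairwiseDisjoint hI, ?_⟩
  · rw [codisjoint_iff, Submodule.eq_top_iff']
    intro x
    have hx : x = (1 / 2 : ℂ) • (x - Complex.I • J.baseChange ℂ x) +
        (1 / 2 : ℂ) • (x + Complex.I • J.baseChange ℂ x) := by module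
    rw [hx]
    refine Submodule.add_mem_sup (Submodule.smul_mem _ _ ?_) (Submodule.smul_mem _ _ ?_) <;>
    · rw [Module.End.mem_eigenspace_iff]
      simp only [map_sub, map_add, map_smul, LinearMap.baseChange_baseChange_eq_neg hJ, smul_sub,
        smul_add, smul_neg, neg_smul, smul_smul, Complex.I_mul_I]
      match_scalars <;> simp

theorem two_mul_finrank_eigenspace_I [FiniteDimensional ℝ W] {J : W →ₗ[ℝ] W}
    (hJ : J ∘ₗ J = -LinearMap.id) :
    2 * Module.finrank ℂ
      (Module.End.eigenspace (R := ℂ) (M := ℂ ⊗[ℝ] W) (J.baseChange ℂ) Complex.I) =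
      Module.finrank ℝ W := by
  have h₁ := Submodule.finrank_add_eq_of_isCompl (isCompl_eigenspace_I hJ)
  have h₂ := (eigenspaceConjEquiv J).finrank_eq
  have h₃ (μ : ℂ) := Module.finrank_mul_finrank ℝ ℂ
    (Module.End.eigenspace (R := ℂ) (M := ℂ ⊗[ℝ] W) (J.baseChange ℂ) μ)
  rw [← h₃, ← h₃, Complex.finrank_real_complex] at h₂
  rw [Module.finrank_baseChange] at h₁
  omega

theorem LinearMap.BilinForm.isotropic_eigenspace_I {B : LinearMap.BilinForm ℝ W}
    {J : W →ₗ[ℝ] W} (h : ∀ a b, B (J a) b = -B a (J b))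
    {x y : ℂ ⊗[ℝ] W}
    (hx : x ∈ Module.End.eigenspace (R := ℂ) (M := ℂ ⊗[ℝ] W) (J.baseChange ℂ) Complex.I)
    (hy : y ∈ Module.End.eigenspace (R := ℂ) (M := ℂ ⊗[ℝ] W) (J.baseChange ℂ) Complex.I) :
    LinearMap.BilinForm.baseChange ℂ B x y = 0 := by
  rw [Module.End.mem_eigenspace_iff] at hx hy
  have key := LinearMap.BilinForm.baseChange_skew h x y
  rw [hx, hy, map_smul, LinearMap.smul_apply, map_smul, smul_eq_mul, self_eq_neg] at key
  exact (mul_eq_zero.mp key).resolve_left Complex.I_ne_zero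

end Complexification

/-- A generalized almost complex structure `J` on `V` determines a maximal isotropic
subspace `L ⊂ (V ⊕ V*) ⊗ ℂ` with `L ∩ conj L = 0`, namely the `+i`-eigenspace of the
complexification of `J`. -/
theorem stmt5 (V : Type*) [AddCommGroup V] [Module ℝ V] [FiniteDimensional ℝ V]
    (J : (V × Module.Dual ℝ V) →ₗ[ℝ] (V × Module.Dual ℝ V))
    (hJ2 : J ∘ₗ J = -LinearMap.id)
    (hskew : ∀ a b, pairingForm V (J a) b = - pairingForm V a (J b)) :
    ∀ L : Submodule ℂ (ℂ ⊗[ℝ] (V × Module.Dual ℝ V)),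
      L = Module.End.eigenspace (R := ℂ) (M := ℂ ⊗[ℝ] (V × Module.Dual ℝ V)) (J.baseChange ℂ) Complex.I →
      (∀ x ∈ L, ∀ y ∈ L, (pairingForm V).baseChange ℂ x y = 0) ∧
      Module.rank ℂ L = (Module.finrank ℝ V : Cardinal) ∧
      Submodule.restrictScalars ℝ L ⊓
        Submodule.map
          (TensorProduct.map Complex.conjAe.toLinearMap
            (LinearMap.id : (V × Module.Dual ℝ V) →ₗ[ℝ] (V × Module.Dual ℝ V)))
          (Submodule.restrictScalars ℝ L) = ⊥ := by
  rintro L rfl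
  refine ⟨fun x hx y hy => LinearMap.BilinForm.isotropic_eigenspace_I hskew hx hy, ?_, ?_⟩
  · have h := two_mul_finrank_eigenspace_I hJ2
    rw [Module.finrank_prod, Subspace.dual_finrank_eq] at h
    rw [← Module.finrank_eq_rank]
    norm_cast
    omega
  · rw [eq_bot_iff]
    rintro _ ⟨hx, y, hy, rfl⟩
    have hy' := complexificationConj_mem_eigenspace J Complex.I hy
    rw [Complex.conj_I] at hy'
    exact (Submodule.disjoint_def.mp (isCompl_eigenspace_I hJ2).disjoint) _ hx hy'
end

section
/- The stabilizer of J₀ = diag(I₀, I₀) (where I₀ is the block-diagonal 4×4 matrix with 2×2 blocks [[0,-1],[1,0]]) under the conjugation action of O_g(4,4) on Z(4) is isomorphic to U_g(2,2) = U(2,2) ∩ U(4); consequently Z(4) ≅ O_g(4,4)/U_g(2,2). -/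
open Matrix

/-- Realification: a complex 4×4 matrix as a real 8×8 matrix, complex coordinate `k`
corresponding to the pair of real coordinates `(2k, 2k+1)`. -/
noncomputable def realify (A : Matrix (Fin 4) (Fin 4) ℂ) : Matrix (Fin 8) (Fin 8) ℝ :=
  Matrix.of fun i j =>
    let a := A ⟨(i : ℕ) / 2, by omega⟩ ⟨(j : ℕ) / 2, by omega⟩
    if (i : ℕ) % 2 = 0 then (if (j : ℕ) % 2 = 0 then a.re else -a.im)
    else (if (j : ℕ) % 2 = 0 then a.im else a.re)

/-- The complex structure `J₀ = diag(I₀, I₀)`, `I₀` block-diagonal with 2×2 blocks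
`[[0,-1],[1,0]]`: the realification of multiplication by `i`. -/
noncomputable def J₀mat : Matrix (Fin 8) (Fin 8) ℝ := realify (Complex.I • 1)

/-- The pseudo-metric `½[[0,I₄],[I₄,0]]` as an 8×8 real matrix. -/
noncomputable def gMat : Matrix (Fin 8) (Fin 8) ℝ :=
  Matrix.of fun i j => if (i : ℕ) + 4 = (j : ℕ) ∨ (j : ℕ) + 4 = (i : ℕ) then 1 / 2 else 0

/-- The hermitian form of signature `(2,2)` corresponding to the pseudo-metric. -/
noncomputable def hMat : Matrix (Fin 4) (Fin 4) ℂ :=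
  Matrix.of fun i j => if (i : ℕ) + 2 = (j : ℕ) ∨ (j : ℕ) + 2 = (i : ℕ) then 1 / 2 else 0

/-- `O_g(4,4)`: matrices orthogonal for both the pseudo-metric and the Euclidean
metric. -/
def memOg (P : Matrix (Fin 8) (Fin 8) ℝ) : Prop :=
  Pᵀ * gMat * P = gMat ∧ Pᵀ * P = 1

/-- `Z(4) = {u ∈ O_g(4,4) : u² = -Id}`. -/
def memZ4 (u : Matrix (Fin 8) (Fin 8) ℝ) : Prop := memOg u ∧ u * u = -1

theorem realify_mul (A B : Matrix (Fin 4) (Fin 4) ℂ) :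
    realify (A * B) = realify A * realify B := by
  ext i j
  have h : ∀ f : Fin 8 → ℝ, ∑ x, f x = ∑ k : Fin 4,
      (f ⟨2 * (k : ℕ), by omega⟩ + f ⟨2 * (k : ℕ) + 1, by omega⟩) := by
    intro f
    simp only [Fin.sum_univ_succ, Fin.sum_univ_zero]
    simp [add_assoc]
  have h2 (k : ℕ) : (2 * k + 1) / 2 = k := by omega
  have h3 (k : ℕ) : 2 * k / 2 = k := by omega
  rw [Matrix.mul_apply, h]
  simp only [realify, Matrix.of_apply, Matrix.mul_apply, Complex.re_sum, Complex.im_sum,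
    Complex.mul_re, Complex.mul_im, h2, h3, Nat.mul_mod_right, Nat.mul_add_mod,
    Nat.one_mod, one_ne_zero, if_true, if_false]
  split_ifs
  all_goals try rw [← Finset.sum_neg_distrib]
  all_goals refine Finset.sum_congr rfl fun k _ => ?_
  all_goals ring

theorem realify_injective : Function.Injective realify := by
  intro A B hAB
  ext k l
  have hre := congr_fun₂ hAB ⟨2 * (k : ℕ), by omega⟩ ⟨2 * (l : ℕ), by omega⟩
  have him := congr_fun₂ hAB ⟨2 * (k : ℕ) + 1, by omega⟩ ⟨2 * (l : ℕ), by omega⟩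
  have h2 (k : ℕ) : (2 * k + 1) / 2 = k := by omega
  have h3 (k : ℕ) : 2 * k / 2 = k := by omega
  simp only [realify, Matrix.of_apply, h2, h3, Nat.mul_mod_right, Nat.mul_add_mod,
    Nat.one_mod, one_ne_zero, if_true, if_false] at hre him
  exact Complex.ext hre him

theorem realify_conjTranspose (A : Matrix (Fin 4) (Fin 4) ℂ) :
    realify Aᴴ = (realify A)ᵀ := by
  ext i j
  simp only [realify, Matrix.of_apply, Matrix.conjTranspose_apply, Matrix.transpose_apply]
  split_ifs <;> simp

theorem realify_one : realify 1 = 1 := by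
  ext i j
  fin_cases i <;> fin_cases j <;> simp [realify, Matrix.one_apply]

theorem realify_neg (A : Matrix (Fin 4) (Fin 4) ℂ) : realify (-A) = -realify A := by
  ext i j
  simp only [realify, Matrix.of_apply, Matrix.neg_apply]
  split_ifs <;> simp

theorem realify_hMat : realify hMat = gMat := by
  ext i j
  fin_cases i <;> fin_cases j <;> simp [realify, hMat, gMat]

theorem memOg_realify_iff (A : Matrix (Fin 4) (Fin 4) ℂ) :
    memOg (realify A) ↔ Aᴴ * hMat * A = hMat ∧ Aᴴ * A = 1 := by
  rw [memOg, ← realify_conjTranspose, ← realify_hMat, ← realify_one, ← realify_mul,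
    ← realify_mul, ← realify_mul, realify_injective.eq_iff, realify_injective.eq_iff]

theorem memOg_J₀mat : memOg J₀mat := by
  refine (memOg_realify_iff _).2 ?_
  constructor <;> simp [smul_smul]

theorem J₀mat_mul_self : J₀mat * J₀mat = -1 := by
  rw [J₀mat, ← realify_mul, ← realify_one, ← realify_neg]
  simp [smul_smul]

theorem realify_mul_J₀mat (A : Matrix (Fin 4) (Fin 4) ℂ) :
    realify A * J₀mat = J₀mat * realify A := by
  rw [J₀mat, ← realify_mul, ← realify_mul]
  simp

theorem Fin.exists_eq_two_mul_or (i : Fin 8) :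
    ∃ k : Fin 4, i = ⟨2 * (k : ℕ), by omega⟩ ∨ i = ⟨2 * (k : ℕ) + 1, by omega⟩ :=
  ⟨⟨(i : ℕ) / 2, by omega⟩, by simp only [Fin.ext_iff]; omega⟩

theorem mul_J₀mat_apply_even (P : Matrix (Fin 8) (Fin 8) ℝ) (i : Fin 8) (l : Fin 4) :
    (P * J₀mat) i ⟨2 * (l : ℕ), by omega⟩ = P i ⟨2 * (l : ℕ) + 1, by omega⟩ := by
  fin_cases l <;>
    simp [realify, J₀mat, Matrix.mul_apply, Fin.sum_univ_succ, Matrix.one_apply]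

theorem J₀mat_mul_apply_even (P : Matrix (Fin 8) (Fin 8) ℝ) (k : Fin 4) (j : Fin 8) :
    (J₀mat * P) ⟨2 * (k : ℕ), by omega⟩ j = -P ⟨2 * (k : ℕ) + 1, by omega⟩ j := by
  fin_cases k <;>
    simp [realify, J₀mat, Matrix.mul_apply, Fin.sum_univ_succ, Matrix.one_apply]

theorem J₀mat_mul_apply_odd (P : Matrix (Fin 8) (Fin 8) ℝ) (k : Fin 4) (j : Fin 8) :
    (J₀mat * P) ⟨2 * (k : ℕ) + 1, by omega⟩ j = P ⟨2 * (k : ℕ), by omega⟩ j := by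
  fin_cases k <;>
    simp [realify, J₀mat, Matrix.mul_apply, Fin.sum_univ_succ, Matrix.one_apply]

theorem exists_realify_eq {P : Matrix (Fin 8) (Fin 8) ℝ} (h : P * J₀mat = J₀mat * P) :
    ∃ A, realify A = P := by
  refine ⟨Matrix.of fun k l => ⟨P ⟨2 * (k : ℕ), by omega⟩ ⟨2 * (l : ℕ), by omega⟩,
    P ⟨2 * (k : ℕ) + 1, by omega⟩ ⟨2 * (l : ℕ), by omega⟩⟩, ?_⟩
  have h2 (k : ℕ) : (2 * k + 1) / 2 = k := by omega
  have h3 (k : ℕ) : 2 * k / 2 = k := by omega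
  ext i j
  obtain ⟨k, rfl | rfl⟩ := i.exists_eq_two_mul_or <;>
    obtain ⟨l, rfl | rfl⟩ := j.exists_eq_two_mul_or <;>
    simp only [realify, Matrix.of_apply, h2, h3, Nat.mul_mod_right, Nat.mul_add_mod,
      Nat.one_mod, one_ne_zero, if_true, if_false]
  · rw [← J₀mat_mul_apply_even, ← h, mul_J₀mat_apply_even]
  · rw [← J₀mat_mul_apply_odd P, ← h, mul_J₀mat_apply_even]

theorem memOg.mul_transpose {P : Matrix (Fin 8) (Fin 8) ℝ} (h : memOg P) : P * Pᵀ = 1 :=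
  mul_eq_one_comm.1 h.2

theorem memOg.inv_eq {P : Matrix (Fin 8) (Fin 8) ℝ} (h : memOg P) : P⁻¹ = Pᵀ :=
  Matrix.inv_eq_left_inv h.2

theorem memOg.mul_inv {P : Matrix (Fin 8) (Fin 8) ℝ} (h : memOg P) : P * P⁻¹ = 1 := by
  rw [h.inv_eq, h.mul_transpose]

theorem memOg.inv_mul {P : Matrix (Fin 8) (Fin 8) ℝ} (h : memOg P) : P⁻¹ * P = 1 := by
  rw [h.inv_eq, h.2]

theorem memOg.mul {P Q : Matrix (Fin 8) (Fin 8) ℝ} (hP : memOg P) (hQ : memOg Q) :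
    memOg (P * Q) := by
  constructor
  · calc (P * Q)ᵀ * gMat * (P * Q) = Qᵀ * (Pᵀ * gMat * P) * Q := by
          simp only [Matrix.transpose_mul, Matrix.mul_assoc]
      _ = gMat := by rw [hP.1, hQ.1]
  · calc (P * Q)ᵀ * (P * Q) = Qᵀ * (Pᵀ * P) * Q := by
          simp only [Matrix.transpose_mul, Matrix.mul_assoc]
      _ = 1 := by rw [hP.2, Matrix.mul_one, hQ.2]

theorem memOg.inv {P : Matrix (Fin 8) (Fin 8) ℝ} (h : memOg P) : memOg P⁻¹ := by
  rw [h.inv_eq]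
  refine ⟨?_, by rw [Matrix.transpose_transpose, h.mul_transpose]⟩
  calc Pᵀᵀ * gMat * Pᵀ = Pᵀᵀ * (Pᵀ * gMat * P) * Pᵀ := by rw [h.1]
    _ = (P * Pᵀ) * gMat * (P * Pᵀ) := by
        simp only [Matrix.transpose_transpose, Matrix.mul_assoc]
    _ = gMat := by rw [h.mul_transpose, Matrix.one_mul, Matrix.mul_one]

theorem memOg.conj_eq_iff {P : Matrix (Fin 8) (Fin 8) ℝ} (h : memOg P)
    {X Y : Matrix (Fin 8) (Fin 8) ℝ} : P * X * P⁻¹ = Y ↔ P * X = Y * P := by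
  constructor
  · rintro rfl
    rw [Matrix.mul_assoc _ P⁻¹, h.inv_mul, Matrix.mul_one]
  · intro e
    rw [e, Matrix.mul_assoc, h.mul_inv, Matrix.mul_one]

theorem memOg.memZ4_conj {P u : Matrix (Fin 8) (Fin 8) ℝ} (h : memOg P) (hu : memZ4 u) :
    memZ4 (P * u * P⁻¹) := by
  refine ⟨(h.mul hu.1).mul h.inv, ?_⟩
  calc P * u * P⁻¹ * (P * u * P⁻¹) = P * (u * (P⁻¹ * P) * u) * P⁻¹ := by
        simp only [Matrix.mul_assoc]
    _ = -1 := by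
        rw [h.inv_mul, Matrix.mul_one, hu.2, Matrix.mul_neg, Matrix.mul_one, Matrix.neg_mul,
          h.mul_inv]

/-- The standard complex structure `I₀` on `ℝ⁴`. -/
def stdComplexStructure : Matrix (Fin 4) (Fin 4) ℝ :=
  !![0, -1, 0, 0; 1, 0, 0, 0; 0, 0, 0, -1; 0, 0, 1, 0]

theorem exists_unit_orthogonal_pair (v w : Fin 4 → ℝ) :
    ∃ x : Fin 4 → ℝ, x ⬝ᵥ x = 1 ∧ v ⬝ᵥ x = 0 ∧ w ⬝ᵥ x = 0 := by
  obtain ⟨x, hx, hx0⟩ : ∃ x : Fin 4 → ℝ, x ≠ 0 ∧ (Matrix.of ![v, w]) *ᵥ x = 0 := by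
    have : ¬ Function.Injective (Matrix.of ![v, w]).mulVecLin := fun hinj => by
      have := LinearMap.finrank_le_finrank_of_injective hinj
      simp at this
    rw [← LinearMap.ker_eq_bot, ← ne_eq, Submodule.ne_bot_iff] at this
    obtain ⟨x, hx, hx0⟩ := this
    exact ⟨x, hx0, hx⟩
  have hv : v ⬝ᵥ x = 0 := congr_fun hx0 0
  have hw : w ⬝ᵥ x = 0 := congr_fun hx0 1
  have hpos : 0 < x ⬝ᵥ x :=
    lt_of_le_of_ne (Finset.sum_nonneg fun i _ => mul_self_nonneg _)
      (Ne.symm fun h => hx (dotProduct_self_eq_zero.1 h))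
  refine ⟨(√(x ⬝ᵥ x))⁻¹ • x, ?_, by simp [hv], by simp [hw]⟩
  rw [smul_dotProduct, dotProduct_smul, smul_eq_mul, smul_eq_mul, ← mul_assoc, ← mul_inv,
    Real.mul_self_sqrt hpos.le, inv_mul_cancel₀ hpos.ne']

theorem exists_orthogonal_conj_stdComplexStructure {a : Matrix (Fin 4) (Fin 4) ℝ}
    (ha : aᵀ * a = 1) (ha2 : a * a = -1) :
    ∃ Q : Matrix (Fin 4) (Fin 4) ℝ, Qᵀ * Q = 1 ∧ Q * stdComplexStructure = a * Q := by
  have hat : aᵀ = -a := by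
    calc aᵀ = -(aᵀ * (a * a)) := by simp [ha2]
      _ = -a := by rw [← Matrix.mul_assoc, ha, Matrix.one_mul]
  have haa (x : Fin 4 → ℝ) : a *ᵥ (a *ᵥ x) = -x := by simp [ha2, Matrix.neg_mulVec]
  have hl (x y : Fin 4 → ℝ) : (a *ᵥ x) ⬝ᵥ y = -(x ⬝ᵥ (a *ᵥ y)) := by
    rw [← Matrix.vecMul_transpose, hat, ← Matrix.dotProduct_mulVec, Matrix.neg_mulVec,
      dotProduct_neg]
  have hs (x : Fin 4 → ℝ) : x ⬝ᵥ (a *ᵥ x) = 0 := by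
    have := hl x x
    rw [dotProduct_comm] at this
    linarith
  obtain ⟨x, hx, -, -⟩ := exists_unit_orthogonal_pair 0 0
  obtain ⟨y, hy, hxy, hay⟩ := exists_unit_orthogonal_pair x (a *ᵥ x)
  have hxay : x ⬝ᵥ (a *ᵥ y) = 0 := by linarith [hl x y]
  have hyx : y ⬝ᵥ x = 0 := by rw [dotProduct_comm, hxy]
  have hyax : y ⬝ᵥ (a *ᵥ x) = 0 := by rw [dotProduct_comm, hay]
  refine ⟨(Matrix.of ![x, a *ᵥ x, y, a *ᵥ y])ᵀ, ?_, ?_⟩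
  · ext i j
    change (![x, a *ᵥ x, y, a *ᵥ y] i) ⬝ᵥ (![x, a *ᵥ x, y, a *ᵥ y] j) = _
    fin_cases i <;> fin_cases j <;>
      simp [-Matrix.mulVec_mulVec, hl, haa, hs, hx, hy, hxy, hxay, hyx, hyax]
  · ext i j
    change _ = (a *ᵥ (![x, a *ᵥ x, y, a *ᵥ y] j)) i
    fin_cases j <;>
      simp [-Matrix.mulVec_mulVec, haa, Matrix.mul_apply, Fin.sum_univ_succ, stdComplexStructure]

/-- `finSumFinEquiv` with codomain `Fin 8`. -/
def sumEquivFinEight : Fin 4 ⊕ Fin 4 ≃ Fin 8 := finSumFinEquiv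

theorem sumEquivFinEight_inl (i : Fin 4) : sumEquivFinEight (Sum.inl i) = ⟨i, by omega⟩ := rfl

theorem sumEquivFinEight_inr (i : Fin 4) : sumEquivFinEight (Sum.inr i) = ⟨4 + i, by omega⟩ := rfl

/-- The identification of `4 + 4` block matrices with `8 × 8` matrices. -/
abbrev blockEquiv : Matrix (Fin 4 ⊕ Fin 4) (Fin 4 ⊕ Fin 4) ℝ ≃ₐ[ℝ] Matrix (Fin 8) (Fin 8) ℝ :=
  Matrix.reindexAlgEquiv ℝ ℝ sumEquivFinEight

theorem blockEquiv_transpose (M : Matrix (Fin 4 ⊕ Fin 4) (Fin 4 ⊕ Fin 4) ℝ) :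
    (blockEquiv M)ᵀ = blockEquiv Mᵀ := rfl

theorem gMat_eq_blockEquiv :
    gMat = blockEquiv (Matrix.fromBlocks 0 ((1 / 2 : ℝ) • 1) ((1 / 2 : ℝ) • 1) 0) := by
  rw [← AlgEquiv.symm_apply_eq]
  ext i j
  rcases i with i | i <;> rcases j with j | j <;> fin_cases i <;> fin_cases j <;>
    simp [gMat, sumEquivFinEight_inl, sumEquivFinEight_inr]

theorem J₀mat_eq_blockEquiv :
    J₀mat = blockEquiv (Matrix.fromBlocks stdComplexStructure 0 0 stdComplexStructure) := by
  rw [← AlgEquiv.symm_apply_eq]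
  ext i j
  rcases i with i | i <;> rcases j with j | j <;> fin_cases i <;> fin_cases j <;>
    simp [J₀mat, realify, Matrix.one_apply, sumEquivFinEight_inl, sumEquivFinEight_inr,
      stdComplexStructure]

/-- In block form, `O_g(4,4)` consists of the matrices `[[A, B], [B, A]]` with `A + B` and
`A - B` orthogonal. -/
theorem memOg_blockEquiv {A B : Matrix (Fin 4) (Fin 4) ℝ} (hs : (A + B)ᵀ * (A + B) = 1)
    (hd : (A - B)ᵀ * (A - B) = 1) : memOg (blockEquiv (Matrix.fromBlocks A B B A)) := by
  simp only [Matrix.transpose_add, Matrix.transpose_sub] at hs hd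
  have h₁ : Aᵀ * A + Bᵀ * B = 1 := by
    have : (2 : ℝ) • (Aᵀ * A + Bᵀ * B) = (2 : ℝ) • 1 := by
      rw [two_smul, two_smul]
      nth_rewrite 1 [← hs]
      rw [← hd]
      noncomm_ring
    exact smul_right_injective _ two_ne_zero this
  have h₂ : Aᵀ * B + Bᵀ * A = 0 := by
    have : (2 : ℝ) • (Aᵀ * B + Bᵀ * A) = (2 : ℝ) • 0 := by
      rw [smul_zero, ← sub_self 1]
      nth_rewrite 1 [← hs]
      rw [← hd, two_smul]
      noncomm_ring
    exact smul_right_injective _ two_ne_zero this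
  constructor
  · rw [gMat_eq_blockEquiv, blockEquiv_transpose, ← map_mul, ← map_mul,
      Matrix.fromBlocks_transpose, Matrix.fromBlocks_multiply, Matrix.fromBlocks_multiply]
    simp only [Matrix.mul_zero, Matrix.mul_smul, Matrix.smul_mul, Matrix.mul_one, zero_add,
      add_zero, ← smul_add]
    rw [add_comm (Bᵀ * A), add_comm (Bᵀ * B), h₁, h₂, smul_zero]
  · rw [blockEquiv_transpose, ← map_mul, Matrix.fromBlocks_transpose,
      Matrix.fromBlocks_multiply, add_comm (Bᵀ * A), add_comm (Bᵀ * B), h₁, h₂,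
      Matrix.fromBlocks_one, map_one]

theorem memOg.exists_blockEquiv {u : Matrix (Fin 8) (Fin 8) ℝ} (h : memOg u) :
    ∃ A B : Matrix (Fin 4) (Fin 4) ℝ, u = blockEquiv (Matrix.fromBlocks A B B A) := by
  obtain ⟨M, rfl⟩ := blockEquiv.surjective u
  obtain ⟨A, B, C, D, rfl⟩ : ∃ A B C D, M = Matrix.fromBlocks A B C D :=
    ⟨_, _, _, _, (Matrix.fromBlocks_toBlocks M).symm⟩
  have hcomm : gMat * blockEquiv (Matrix.fromBlocks A B C D) =
      blockEquiv (Matrix.fromBlocks A B C D) * gMat := by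
    nth_rewrite 2 [← h.1]
    rw [← Matrix.mul_assoc, ← Matrix.mul_assoc, h.mul_transpose, Matrix.one_mul]
  rw [gMat_eq_blockEquiv, ← map_mul, ← map_mul, blockEquiv.injective.eq_iff,
    Matrix.fromBlocks_multiply, Matrix.fromBlocks_multiply, Matrix.fromBlocks_inj] at hcomm
  simp only [Matrix.zero_mul, Matrix.mul_zero, Matrix.mul_smul, Matrix.smul_mul, Matrix.mul_one,
    Matrix.one_mul, zero_add, add_zero] at hcomm
  have hinj := smul_right_injective (Matrix (Fin 4) (Fin 4) ℝ) (one_half_pos (α := ℝ)).ne'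
  exact ⟨A, B, by rw [hinj hcomm.1, hinj hcomm.2.1]⟩

theorem memZ4.exists_conj {u : Matrix (Fin 8) (Fin 8) ℝ} (hu : memZ4 u) :
    ∃ P, memOg P ∧ u = P * J₀mat * P⁻¹ := by
  obtain ⟨A, B, rfl⟩ := hu.1.exists_blockEquiv
  have ho := hu.1.2
  have hsq := hu.2
  rw [blockEquiv_transpose, ← map_mul, ← map_one blockEquiv, blockEquiv.injective.eq_iff,
    Matrix.fromBlocks_transpose, Matrix.fromBlocks_multiply, ← Matrix.fromBlocks_one,
    Matrix.fromBlocks_inj] at ho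
  rw [← map_mul, ← map_one blockEquiv, ← map_neg, blockEquiv.injective.eq_iff,
    Matrix.fromBlocks_multiply, ← Matrix.fromBlocks_one, Matrix.fromBlocks_neg,
    Matrix.fromBlocks_inj, neg_zero] at hsq
  obtain ⟨ho₁, ho₂, -, -⟩ := ho
  obtain ⟨hsq₁, hsq₂, -, -⟩ := hsq
  obtain ⟨Q, hQ, hQa⟩ := exists_orthogonal_conj_stdComplexStructure (a := A + B)
    (by
      rw [← add_zero 1, ← ho₁, ← ho₂, Matrix.transpose_add]
      noncomm_ring)
    (by
      rw [← add_zero (-1), ← hsq₁, ← hsq₂]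
      noncomm_ring)
  obtain ⟨R, hR, hRa⟩ := exists_orthogonal_conj_stdComplexStructure (a := A - B)
    (by
      rw [← sub_zero 1, ← ho₁, ← ho₂, Matrix.transpose_sub]
      noncomm_ring)
    (by
      rw [← sub_zero (-1), ← hsq₁, ← hsq₂]
      noncomm_ring)
  have hadd : (1 / 2 : ℝ) • (Q + R) + (1 / 2 : ℝ) • (Q - R) = Q := by module
  have hsub : (1 / 2 : ℝ) • (Q + R) - (1 / 2 : ℝ) • (Q - R) = R := by module
  have hP : memOg (blockEquiv (Matrix.fromBlocks ((1 / 2 : ℝ) • (Q + R)) ((1 / 2 : ℝ) • (Q - R))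
      ((1 / 2 : ℝ) • (Q - R)) ((1 / 2 : ℝ) • (Q + R)))) :=
    memOg_blockEquiv (by rw [hadd, hQ]) (by rw [hsub, hR])
  refine ⟨_, hP, (hP.conj_eq_iff.2 ?_).symm⟩
  have h₁ : (1 / 2 : ℝ) • (Q + R) * stdComplexStructure =
      A * (1 / 2 : ℝ) • (Q + R) + B * (1 / 2 : ℝ) • (Q - R) := by
    simp only [Matrix.smul_mul, Matrix.mul_smul, Matrix.add_mul, hQa, hRa, ← smul_add]
    congr 1
    noncomm_ring
  have h₂ : (1 / 2 : ℝ) • (Q - R) * stdComplexStructure =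
      A * (1 / 2 : ℝ) • (Q - R) + B * (1 / 2 : ℝ) • (Q + R) := by
    simp only [Matrix.smul_mul, Matrix.mul_smul, Matrix.sub_mul, hQa, hRa, ← smul_add]
    congr 1
    noncomm_ring
  rw [J₀mat_eq_blockEquiv, ← map_mul, ← map_mul, Matrix.fromBlocks_multiply,
    Matrix.fromBlocks_multiply]
  simp only [Matrix.mul_zero, add_zero, zero_add]
  rw [h₁, h₂, add_comm (A * (1 / 2 : ℝ) • (Q - R)), add_comm (A * (1 / 2 : ℝ) • (Q + R))]

/-- The stabilizer of `J₀` under the conjugation action of `O_g(4,4)` on `Z(4)` is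
isomorphic to `U_g(2,2) = U(2,2) ∩ U(4)` (via the multiplicative bijection `realify`);
consequently the orbit map `P ↦ P J₀ P⁻¹` identifies `Z(4)` with
`O_g(4,4)/U_g(2,2)`. -/
theorem stmt11 :
    (Set.BijOn realify
        {A : Matrix (Fin 4) (Fin 4) ℂ | Aᴴ * hMat * A = hMat ∧ Aᴴ * A = 1}
        {P : Matrix (Fin 8) (Fin 8) ℝ | memOg P ∧ P * J₀mat * P⁻¹ = J₀mat} ∧
      ∀ A B : Matrix (Fin 4) (Fin 4) ℂ, realify (A * B) = realify A * realify B) ∧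
    (∀ P, memOg P → memZ4 (P * J₀mat * P⁻¹)) ∧
    (∀ u, memZ4 u → ∃ P, memOg P ∧ u = P * J₀mat * P⁻¹) ∧
    (∀ P Q, memOg P → memOg Q →
      (P * J₀mat * P⁻¹ = Q * J₀mat * Q⁻¹ ↔
        (memOg (P⁻¹ * Q) ∧ (P⁻¹ * Q) * J₀mat * (P⁻¹ * Q)⁻¹ = J₀mat))) := by
  refine ⟨⟨⟨?_, realify_injective.injOn, ?_⟩, realify_mul⟩,
    fun P hP => hP.memZ4_conj ⟨memOg_J₀mat, J₀mat_mul_self⟩, fun u hu => hu.exists_conj, ?_⟩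
  · intro A hA
    have hP := (memOg_realify_iff A).2 hA
    exact ⟨hP, hP.conj_eq_iff.2 (realify_mul_J₀mat A)⟩
  · rintro P ⟨hP, hJ⟩
    obtain ⟨A, rfl⟩ := exists_realify_eq (hP.conj_eq_iff.1 hJ)
    exact ⟨A, (memOg_realify_iff A).1 hP, rfl⟩
  · intro P Q hP hQ
    have hPQ := hP.inv.mul hQ
    rw [and_iff_right hPQ, hPQ.conj_eq_iff, eq_comm, hQ.conj_eq_iff]
    constructor
    · intro h
      calc P⁻¹ * Q * J₀mat = P⁻¹ * (Q * J₀mat) := by rw [Matrix.mul_assoc]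
        _ = (P⁻¹ * P) * J₀mat * (P⁻¹ * Q) := by rw [h]; simp only [Matrix.mul_assoc]
        _ = J₀mat * (P⁻¹ * Q) := by rw [hP.inv_mul, Matrix.one_mul]
    · intro h
      calc Q * J₀mat = (P * P⁻¹) * Q * J₀mat := by rw [hP.mul_inv, Matrix.one_mul]
        _ = P * (P⁻¹ * Q * J₀mat) := by simp only [Matrix.mul_assoc]
        _ = P * J₀mat * P⁻¹ * Q := by rw [h]; simp only [Matrix.mul_assoc]
end
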